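/- arXiv:1911.03009 — 12 statements merged into one kernel-verified Lean document; each statement's English description precedes it below -/
import Mathlib

section
/- Let X be a set with binary operation · forming a Rump right quasigroup, and write x/y for the inverse of the right translation r_y (so (x/y)·y = x and (x·y)/y = x). Then the map R : X × X → X × X defined by R(x,y) = (y·(x/y), x/y) is an involutive right non-degenerate set-theoretic solution of the Yang–Baxter equation; that is, (R × Id)(Id × R)(R × Id) = (Id × R)(R × Id)(Id × R), R ∘ R = Id, and for each y ∈ X the map x ↦ R₂(x,y) is bijective, where R(x,y) = (R₁(x,y), R₂(x,y)). -/
/-- `R × Id` acting on the first two coordinates of a triple. -/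
def R12 {X : Type*} (R : X × X → X × X) (p : X × X × X) : X × X × X :=
  ((R (p.1, p.2.1)).1, (R (p.1, p.2.1)).2, p.2.2)

/-- `Id × R` acting on the last two coordinates of a triple. -/
def R23 {X : Type*} (R : X × X → X × X) (p : X × X × X) : X × X × X :=
  (p.1, R (p.2.1, p.2.2))

/-- If `(X, mul)` is a Rump right quasigroup (with right division `div`), then
`R(x,y) = (y·(x/y), x/y)` is an involutive right non-degenerate set-theoretic
solution of the Yang-Baxter equation. -/
theorem stmt0 {X : Type*} (mul div : X → X → X)
    (hdm : ∀ x y, mul (div x y) y = x) (hmd : ∀ x y, div (mul x y) y = x)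
    (rump : ∀ x y z, mul (mul z x) (mul y x) = mul (mul z y) (mul x y))
    (R : X × X → X × X) (hR : ∀ x y, R (x, y) = (mul y (div x y), div x y)) :
    (∀ p : X × X × X, R12 R (R23 R (R12 R p)) = R23 R (R12 R (R23 R p))) ∧
    (∀ p : X × X, R (R p) = p) ∧
    (∀ y : X, Function.Bijective fun x => (R (x, y)).2) := by
  have swap (u y : X) : R (mul u y, y) = (mul y u, u) := by rw [hR, hmd]
  refine ⟨?_, ?_, ?_⟩
  · have key (a b c : X) :
        R12 R (R23 R (R12 R (mul (mul a c) (mul b c), mul b c, c))) =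
          R23 R (R12 R (R23 R (mul (mul a c) (mul b c), mul b c, c))) := by
      have left : R12 R (R23 R (R12 R (mul (mul a c) (mul b c), mul b c, c))) =
          (mul (mul c a) (mul b a), mul b a, a) := by
        simp only [R12, R23, swap]
        rw [rump c a b, swap]
      have right : R23 R (R12 R (R23 R (mul (mul a c) (mul b c), mul b c, c))) =
          (mul (mul c b) (mul a b), mul b a, a) := by
        simp only [R12, R23, swap]
        rw [rump c b a, swap, swap]
      rw [left, right, rump a b c]
    rintro ⟨x, y, z⟩
    simpa only [hdm] using key (div (div x y) z) (div y z) z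
  · rintro ⟨x, y⟩
    have h := swap (div x y) y
    rw [hdm] at h
    rw [h, swap, hdm]
  · intro y
    simp only [hR]
    exact Function.bijective_iff_has_inverse.mpr
      ⟨fun x => mul x y, fun x => hdm x y, fun x => hmd x y⟩
end

section
/- Let R : X × X → X × X be an involutive right non-degenerate set-theoretic solution of the Yang–Baxter equation on a set X, with R(x,y) = (R₁(x,y), R₂(x,y)). Define a binary operation on X by x·y = (R₂(−,y))⁻¹(x), i.e., x·y is the unique element z with R₂(z,y) = x. Then (X,·) is a Rump right quasigroup: each right translation x ↦ x·y is bijective, and (z·x)·(y·x) = (z·y)·(x·y) holds for all x,y,z ∈ X. -/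
/-- If `R` is an involutive right non-degenerate set-theoretic solution of the
Yang-Baxter equation and `mul x y` is the unique element `z` with `R₂(z, y) = x`
(i.e. `x·y = (R₂(−,y))⁻¹(x)`), then `(X, mul)` is a Rump right quasigroup. -/
theorem stmt1 {X : Type*} (R : X × X → X × X)
    (hYB : ∀ p : X × X × X, R12 R (R23 R (R12 R p)) = R23 R (R12 R (R23 R p)))
    (hinv : ∀ p : X × X, R (R p) = p)
    (hnd : ∀ y : X, Function.Bijective fun x => (R (x, y)).2)
    (mul : X → X → X) (hmul : ∀ x y, (R (mul x y, y)).2 = x) :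
    (∀ y : X, Function.Bijective fun x => mul x y) ∧
    (∀ x y z : X, mul (mul z x) (mul y x) = mul (mul z y) (mul x y)) := by
  have mul_eq {x y w : X} (h : (R (w, y)).2 = x) : mul x y = w :=
    (hnd y).injective ((hmul x y).trans h.symm)
  have R_mul (x y : X) : R (mul x y, y) = (mul y x, x) := by
    have hR : R (mul x y, y) = ((R (mul x y, y)).1, x) := Prod.ext rfl (hmul x y)
    have hR' := hinv (mul x y, y)
    rw [hR] at hR'
    rw [hR, ← mul_eq (congrArg Prod.snd hR')]
  refine ⟨fun y => ⟨fun a b hab => ?_, fun w => ⟨(R (w, y)).2, mul_eq rfl⟩⟩, fun x y z => ?_⟩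
  · rw [← hmul a y, ← hmul b y]
    exact congrArg (fun w => (R (w, y)).2) hab
  · apply mul_eq
    have h := congrArg (fun p => p.2.2) (hYB (mul (mul z y) (mul x y), mul x y, y))
    simp only [R12, R23, hmul, R_mul x y] at h
    exact (mul_eq h.symm).symm
end

section
/- The two constructions of Rump's theorem are mutually inverse: (i) if (X,·) is a Rump right quasigroup and R(x,y) = (y·(x/y), x/y) is the associated solution, then the operation defined from R by x ∘ y = (R₂(−,y))⁻¹(x) coincides with the original operation ·; (ii) if R is an involutive right non-degenerate set-theoretic solution of the Yang–Baxter equation on X and (X,·) is the associated Rump right quasigroup given by x·y = (R₂(−,y))⁻¹(x), then the solution built from (X,·) by (x,y) ↦ (y·(x/y), x/y) equals R. Hence there is a one-to-one correspondence between involutive right non-degenerate solutions of the Yang–Baxter equation on X and Rump right quasigroup structures on X. -/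
/-- `R` is a set-theoretic solution of the Yang-Baxter equation. -/
def IsYB {X : Type*} (R : X × X → X × X) : Prop :=
  ∀ p : X × X × X, R12 R (R23 R (R12 R p)) = R23 R (R12 R (R23 R p))

/-- `R` is an involutive right non-degenerate set-theoretic solution of the
Yang-Baxter equation. -/
def IsInvRNDSolution {X : Type*} (R : X × X → X × X) : Prop :=
  IsYB R ∧ (∀ p : X × X, R (R p) = p) ∧ ∀ y : X, Function.Bijective fun x => (R (x, y)).2

/-- `mul` is a Rump right quasigroup operation on `X`. -/
def IsRump {X : Type*} (mul : X → X → X) : Prop :=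
  (∀ y : X, Function.Bijective fun x => mul x y) ∧
  ∀ x y z : X, mul (mul z x) (mul y x) = mul (mul z y) (mul x y)

section RumpCorrespondence

variable {X : Type*} {R : X × X → X × X} {mul div : X → X → X}

/-- For an involutive `R`, a right section `mul` of the second components `R₂(-, y)` also
determines the first components. -/
theorem apply_mul_eq (hR : IsInvRNDSolution R) (hmul : ∀ x y, (R (mul x y, y)).2 = x) (x y : X) :
    R (mul x y, y) = (mul y x, x) := by
  have hinv : R ((R (mul x y, y)).1, x) = (mul x y, y) := by
    have hpair : ((R (mul x y, y)).1, x) = R (mul x y, y) := Prod.ext rfl (hmul x y).symm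
    rw [hpair, hR.2.1]
  refine Prod.ext ((hR.2.2 x).1 ?_) (hmul x y)
  simp [hinv, hmul]

theorem isRump_of_isInvRNDSolution (hR : IsInvRNDSolution R)
    (hmul : ∀ x y, (R (mul x y, y)).2 = x) : IsRump mul := by
  have happ := apply_mul_eq hR hmul
  have hdiv : ∀ x y, mul (R (x, y)).2 y = x := fun x y => (hR.2.2 y).1 (hmul _ y)
  refine ⟨fun y => Function.bijective_iff_has_inverse.2
    ⟨fun x => (R (x, y)).2, fun x => hmul x y, fun x => hdiv x y⟩, fun x y z => ?_⟩
  have hYB := congrArg (fun p => p.2.2) (hR.1 (mul (mul z x) (mul y x), mul y x, x))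
  simp only [R12, R23, happ] at hYB
  have hzy : (R (mul (mul z x) (mul y x), mul x y)).2 = mul z y :=
    (hdiv _ y).symm.trans (congrArg (mul · y) hYB.symm)
  rw [← hzy, hdiv]

theorem isInvRNDSolution_of_rump (h₁ : ∀ x y, mul (div x y) y = x)
    (h₂ : ∀ x y, div (mul x y) y = x)
    (h : ∀ x y z, mul (mul z x) (mul y x) = mul (mul z y) (mul x y)) :
    IsInvRNDSolution fun p : X × X => (mul p.2 (div p.1 p.2), div p.1 p.2) := by
  refine ⟨?_, fun p => by simp [h₁, h₂], fun y => Function.bijective_iff_has_inverse.2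
    ⟨fun x => mul x y, fun x => h₁ x y, fun x => h₂ x y⟩⟩
  rintro ⟨x, y, c⟩
  obtain ⟨b, rfl⟩ : ∃ b, mul b c = y := ⟨_, h₁ y c⟩
  obtain ⟨u, rfl⟩ : ∃ u, mul u (mul b c) = x := ⟨_, h₁ x _⟩
  obtain ⟨a, rfl⟩ : ∃ a, mul a c = u := ⟨_, h₁ u c⟩
  simp only [R12, R23, h₂]
  rw [h c a b, h c b a]
  simp only [h₂]
  rw [h a b c]

/-- The operation `x · y = R₂(-, y)⁻¹(x)` associated with a solution. -/
noncomputable def IsInvRNDSolution.rumpMul (hR : IsInvRNDSolution R) (x y : X) : X :=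
  (Equiv.ofBijective _ (hR.2.2 y)).symm x

theorem IsInvRNDSolution.apply_rumpMul_snd (hR : IsInvRNDSolution R) (x y : X) :
    (R (hR.rumpMul x y, y)).2 = x :=
  (Equiv.ofBijective _ (hR.2.2 y)).apply_symm_apply x

/-- The right division of a Rump right quasigroup. -/
noncomputable def IsRump.rightDiv (h : IsRump mul) (x y : X) : X :=
  (Equiv.ofBijective _ (h.1 y)).symm x

theorem IsRump.mul_rightDiv (h : IsRump mul) (x y : X) : mul (h.rightDiv x y) y = x :=
  (Equiv.ofBijective _ (h.1 y)).apply_symm_apply x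

theorem IsRump.rightDiv_mul (h : IsRump mul) (x y : X) : h.rightDiv (mul x y) y = x :=
  (Equiv.ofBijective _ (h.1 y)).symm_apply_apply x

theorem op_eq_of_div_op (h₁ : ∀ x y, mul (div x y) y = x) {op : X → X → X}
    (hop : ∀ x y, div (op x y) y = x) : op = mul := by
  funext x y
  rw [← h₁ (op x y) y, hop]

theorem apply_eq_of_mul_div (hR : IsInvRNDSolution R) (hmul : ∀ x y, (R (mul x y, y)).2 = x)
    (h₁ : ∀ x y, mul (div x y) y = x) (x y : X) :
    R (x, y) = (mul y (div x y), div x y) := by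
  simpa only [h₁] using apply_mul_eq hR hmul (div x y) y

/-- Rump's one-to-one correspondence. -/
noncomputable def rumpEquiv (X : Type*) :
    {R : X × X → X × X // IsInvRNDSolution R} ≃ {mul : X → X → X // IsRump mul} where
  toFun R := ⟨R.2.rumpMul, isRump_of_isInvRNDSolution R.2 R.2.apply_rumpMul_snd⟩
  invFun m := ⟨_, isInvRNDSolution_of_rump m.2.mul_rightDiv m.2.rightDiv_mul m.2.2⟩
  left_inv R := Subtype.ext <| funext fun p =>
    (apply_eq_of_mul_div R.2 R.2.apply_rumpMul_snd (IsRump.mul_rightDiv _) p.1 p.2).symm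
  right_inv m := Subtype.ext <| op_eq_of_div_op m.2.mul_rightDiv <|
    (isInvRNDSolution_of_rump m.2.mul_rightDiv m.2.rightDiv_mul m.2.2).apply_rumpMul_snd

end RumpCorrespondence

/-- Rump's correspondence: (i) starting from a Rump right quasigroup `(X, mul)`
(with right division `div`), forming the solution `R(x,y) = (y·(x/y), x/y)` and
then the operation `op` with `R₂(op x y, y) = x` recovers `mul`;
(ii) starting from an involutive right non-degenerate solution `R`, forming the
operation `mul` with `R₂(mul x y, y) = x` (with right division `div`) and then
the solution `(x,y) ↦ (y·(x/y), x/y)` recovers `R`.  Hence involutive right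
non-degenerate solutions on `X` are in one-to-one correspondence with Rump
right quasigroup structures on `X`. -/
theorem stmt2 {X : Type*} :
    (∀ mul div : X → X → X,
      (∀ x y, mul (div x y) y = x) → (∀ x y, div (mul x y) y = x) →
      (∀ x y z, mul (mul z x) (mul y x) = mul (mul z y) (mul x y)) →
      ∀ op : X → X → X,
        (∀ x y, ((fun p : X × X => (mul p.2 (div p.1 p.2), div p.1 p.2)) (op x y, y)).2 = x) →
        op = mul) ∧
    (∀ R : X × X → X × X, IsInvRNDSolution R →
      ∀ mul div : X → X → X,
        (∀ x y, (R (mul x y, y)).2 = x) →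
        (∀ x y, mul (div x y) y = x) → (∀ x y, div (mul x y) y = x) →
        ∀ x y, R (x, y) = (mul y (div x y), div x y)) ∧
    Nonempty ({R : X × X → X × X // IsInvRNDSolution R} ≃ {mul : X → X → X // IsRump mul}) := by
  exact ⟨fun _ _ h₁ _ _ _ hop => op_eq_of_div_op h₁ hop,
    fun _ hR _ _ hmul h₁ _ => apply_eq_of_mul_div hR hmul h₁, ⟨rumpEquiv X⟩⟩
end

section
/- Every uniquely 2-divisible Rump right quasigroup is Δ-bijective; that is, if (X,·) is a Rump right quasigroup in which the squaring map x ↦ x·x is a bijection, then the map Δ : X × X → X × X defined by Δ(x,y) = (x·y, y·x) is a bijection. -/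
/-- Every uniquely 2-divisible Rump right quasigroup is Δ-bijective: if the
squaring map `x ↦ x·x` of a Rump right quasigroup is a bijection, then the map
`Δ(x,y) = (x·y, y·x)` is a bijection of `X × X`. -/
theorem stmt3 {X : Type*} (mul div : X → X → X)
    (hdm : ∀ x y, mul (div x y) y = x) (hmd : ∀ x y, div (mul x y) y = x)
    (rump : ∀ x y z, mul (mul z x) (mul y x) = mul (mul z y) (mul x y))
    (hsq : Function.Bijective fun x => mul x x) :
    Function.Bijective fun p : X × X => (mul p.1 p.2, mul p.2 p.1) := by
  have square_mul : ∀ x y, mul (mul x x) (mul y x) = mul (mul x y) (mul x y) :=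
    fun x y => rump x y x
  constructor
  · rintro ⟨x, y⟩ ⟨x', y'⟩ h
    obtain ⟨hu, hv⟩ : mul x y = mul x' y' ∧ mul y x = mul y' x' := Prod.mk.inj h
    have hx : x = x' := hsq.1 <| show mul x x = mul x' x' by
      rw [← hmd (mul x x) (mul y x), square_mul, hu, hv, ← square_mul, hmd]
    subst hx
    have hy : y = y' := by rw [← hmd y x, hv, hmd]
    rw [hy]
  · rintro ⟨u, v⟩
    obtain ⟨x, hx⟩ : ∃ x, mul x x = div (mul u u) v := hsq.2 _
    have huv : mul x (div v x) = u := hsq.1 <| by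
      change mul (mul x (div v x)) (mul x (div v x)) = mul u u
      rw [← square_mul, hdm, hx, hdm]
    exact ⟨(x, div v x), Prod.ext huv (hdm v x)⟩
end

section
/- Every finite Rump right quasigroup is uniquely 2-divisible; that is, if (X,·) is a Rump right quasigroup with X a finite set, then the squaring map x ↦ x·x is a bijection of X. -/
/-- The commuting transformations `g ↦ r (g x) * g` of the symmetric group attached to a family of
permutations `r` with `r (r x y) * r x` symmetric in `x` and `y`. -/
def permShift {X : Type*} (r : X → Equiv.Perm X) (x : X) (g : Equiv.Perm X) : Equiv.Perm X :=
  r (g x) * g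

theorem permShift_commute {X : Type*} {r : X → Equiv.Perm X}
    (hr : ∀ x y, r (r x y) * r x = r (r y x) * r y) (x y : X) :
    Function.Commute (permShift r x) (permShift r y) := by
  intro g
  simp only [permShift, Equiv.Perm.mul_apply, ← mul_assoc, hr (g y) (g x)]

theorem exists_commute_permShift_eq_pow_mul {X : Type*} {r : X → Equiv.Perm X}
    (hr : ∀ x y, r (r x y) * r x = r (r y x) * r y) (x u : X) (g : Equiv.Perm X) (n : ℕ) :
    ∃ W : Equiv.Perm X → Equiv.Perm X,
      Function.Commute (permShift r x) W ∧ W g = r u ^ n * g := by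
  induction n with
  | zero => exact ⟨id, fun _ => rfl, by simp⟩
  | succ n ih =>
    obtain ⟨W, hW, hWg⟩ := ih
    refine ⟨permShift r ((r u ^ n * g)⁻¹ u) ∘ W, (permShift_commute hr x _).comp_right hW, ?_⟩
    rw [Function.comp_apply, hWg, permShift, Equiv.Perm.inv_def, Equiv.apply_symm_apply, ← mul_assoc, ← pow_succ']

theorem permShift_injective {X : Type*} [Finite X] {r : X → Equiv.Perm X}
    (hr : ∀ x y, r (r x y) * r x = r (r y x) * r y) (x : X) :
    Function.Injective (permShift r x) := by
  refine Finite.injective_iff_surjective.mpr fun g => ?_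
  obtain ⟨W, hW, hWg⟩ := exists_commute_permShift_eq_pow_mul hr x (g x) (permShift r x g)
    (orderOf (r (g x)) - 1)
  refine ⟨W g, ?_⟩
  rw [hW g, hWg, permShift, ← mul_assoc, ← pow_succ, Nat.sub_add_cancel (orderOf_pos _),
    pow_orderOf_eq_one, one_mul]

/-- Every finite Rump right quasigroup is uniquely 2-divisible: the squaring
map `x ↦ x·x` of a finite Rump right quasigroup is a bijection. -/
theorem stmt4 {X : Type*} [Finite X] (mul div : X → X → X)
    (hdm : ∀ x y, mul (div x y) y = x) (hmd : ∀ x y, div (mul x y) y = x)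
    (rump : ∀ x y z, mul (mul z x) (mul y x) = mul (mul z y) (mul x y)) :
    Function.Bijective fun x => mul x x := by
  let r : X → Equiv.Perm X := fun y =>
    ⟨fun x => mul x y, fun x => div x y, fun x => hmd x y, fun x => hdm x y⟩
  have hr : ∀ x y, r (r x y) * r x = r (r y x) * r y := fun x y => Equiv.ext (rump x y)
  have shift_inv (y : X) : permShift r (r y y) (r y)⁻¹ = 1 := by
    rw [permShift, Equiv.Perm.inv_def, Equiv.symm_apply_apply, ← Equiv.Perm.inv_def, mul_inv_cancel]
  refine Finite.injective_iff_bijective.mp fun y z (h : r y y = r z z) => ?_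
  have hyz : r y = r z := inv_injective <| permShift_injective hr (r y y) <| by
    rw [shift_inv, h, shift_inv]
  exact (r z).injective (hyz ▸ h)
end

section
/- A Rump right quasigroup (X,·) is uniquely 2-divisible if and only if the corresponding solution of the Yang–Baxter equation is non-degenerate; that is, the squaring map x ↦ x·x is a bijection of X if and only if, for the solution R(x,y) = (y·(x/y), x/y), the map y ↦ R₁(x,y) is bijective for every x ∈ X (right non-degeneracy of R being automatic). -/
/-- A Rump right quasigroup is uniquely 2-divisible iff the corresponding
Yang-Baxter solution `R(x,y) = (y·(x/y), x/y)` is non-degenerate: the squaring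
map `x ↦ x·x` is a bijection iff `y ↦ R₁(x,y)` is bijective for every `x`
(right non-degeneracy of `R` being automatic). -/
theorem stmt5 {X : Type*} (mul div : X → X → X)
    (hdm : ∀ x y, mul (div x y) y = x) (hmd : ∀ x y, div (mul x y) y = x)
    (rump : ∀ x y z, mul (mul z x) (mul y x) = mul (mul z y) (mul x y)) :
    (Function.Bijective fun x => mul x x) ↔
      ∀ x : X, Function.Bijective fun y =>
        ((fun p : X × X => (mul p.2 (div p.1 p.2), div p.1 p.2)) (x, y)).1 := by
  change _ ↔ ∀ x, Function.Bijective fun y => mul y (div x y)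
  constructor
  · intro hsq x
    -- Squaring conjugates `y ↦ y·(x/y)` to the right translation by `x`.
    have hconj : (fun y => mul y y) ∘ (fun y => mul y (div x y)) =
        (fun y => mul y x) ∘ fun y => mul y y := by
      funext y
      simpa only [Function.comp_apply, hdm] using rump (div x y) y y
    have hright : Function.Bijective fun y => mul y x :=
      Function.bijective_iff_has_inverse.2
        ⟨fun y => div y x, fun y => hmd y x, fun y => hdm y x⟩
    rw [← hsq.of_comp_iff', hconj]
    exact hright.comp hsq
  · refine fun h => ⟨fun x y hxy => ?_, fun s => ?_⟩
    · have hxy' : mul x x = mul y y := hxy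
      apply (h (mul x x)).injective
      simp only [hmd]
      rw [hxy', hmd]
    · obtain ⟨y, hy : mul y (div s y) = s⟩ := (h s).surjective s
      have hdiv : div s (div s y) = y := by
        simpa only [hy] using hmd y (div s y)
      have heq : div s y = y := by
        apply (h s).injective
        simp only [hdiv, hdm, hy]
      exact ⟨y, by simpa only [heq] using hy⟩
end

section
/- Every Δ-bijective magma is uniquely 2-divisible; that is, if (X,·) is a magma such that the map Δ : X × X → X × X, Δ(x,y) = (x·y, y·x), is a bijection, then the squaring map x ↦ x·x is a bijection of X. -/
/-- Every Δ-bijective magma is uniquely 2-divisible: if the map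
`Δ(x,y) = (x·y, y·x)` is a bijection of `X × X`, then the squaring map
`x ↦ x·x` is a bijection of `X`. -/
theorem stmt6 {X : Type*} (mul : X → X → X)
    (hΔ : Function.Bijective fun p : X × X => (mul p.1 p.2, mul p.2 p.1)) :
    Function.Bijective fun x => mul x x := by
  refine ⟨fun x y h => ?_, fun z => ?_⟩
  · have hxy : mul x x = mul y y := h
    exact congrArg Prod.fst (@hΔ.1 (x, x) (y, y) (Prod.ext hxy hxy))
  · obtain ⟨⟨x, y⟩, h⟩ := hΔ.2 (z, z)
    obtain ⟨h₁, h₂⟩ : mul x y = z ∧ mul y x = z := Prod.ext_iff.mp h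
    have hxy : x = y :=
      congrArg Prod.fst (@hΔ.1 (x, y) (y, x) (Prod.ext (h₁.trans h₂.symm) (h₂.trans h₁.symm)))
    subst hxy
    exact ⟨x, h₁⟩
end

section
/- Let M be a module over the Laurent polynomial ring ℤ[t,t⁻¹], and equip M with the Alexander quandle operation a * b = t·a + (1−t)·b. Then (M,*) is a Rump right quasigroup (i.e., satisfies (z*x)*(y*x) = (z*y)*(x*y) for all x,y,z ∈ M) if and only if (1−t)² annihilates every element of M, i.e., (1−t)²·x = 0 for all x ∈ M. -/
open LaurentPolynomial

/-- The Alexander quandle operation `a * b = t•a + (1−t)•b` on a module `M`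
over the Laurent polynomial ring `ℤ[t,t⁻¹]`. -/
noncomputable def alexOp (M : Type*) [AddCommGroup M] [Module (LaurentPolynomial ℤ) M] (a b : M) : M :=
  (T 1 : LaurentPolynomial ℤ) • a + (1 - T 1 : LaurentPolynomial ℤ) • b

/-- An Alexander quandle `(M, a * b = t•a + (1−t)•b)` over the Laurent
polynomial ring `ℤ[t,t⁻¹]` is a Rump right quasigroup (i.e. satisfies the Rump
identity `(z*x)*(y*x) = (z*y)*(x*y)`) iff `(1−t)²` annihilates every element
of `M`. -/
theorem stmt7 (M : Type*) [AddCommGroup M] [Module (LaurentPolynomial ℤ) M] :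
    (∀ x y z : M,
        alexOp M (alexOp M z x) (alexOp M y x) = alexOp M (alexOp M z y) (alexOp M x y))
      ↔ ∀ x : M, ((1 - T 1 : LaurentPolynomial ℤ) ^ 2) • x = 0 := by
  have sub_eq (x y z : M) :
      alexOp M (alexOp M z x) (alexOp M y x) - alexOp M (alexOp M z y) (alexOp M x y)
        = ((1 - T 1 : LaurentPolynomial ℤ) ^ 2) • (x - y) := by
    simp only [alexOp]
    module
  constructor
  · intro h x
    simpa [h x 0 0] using (sub_eq x 0 0).symm
  · intro h x y z
    rw [← sub_eq_zero, sub_eq, h]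
end

section
/- Let (X,·) be a finite Rump right quasigroup. Then for every x ∈ X there exists a unique y ∈ X such that x·(y/x) = y, namely y = x·x. -/
/-- In a finite Rump right quasigroup, for every `x` there is a unique `y` with
`x·(y/x) = y`, namely `y = x·x`. -/
theorem stmt13 {X : Type*} [Finite X] (mul div : X → X → X)
    (hdm : ∀ x y, mul (div x y) y = x) (hmd : ∀ x y, div (mul x y) y = x)
    (rump : ∀ x y z, mul (mul z x) (mul y x) = mul (mul z y) (mul x y))
    (x : X) :
    mul x (div (mul x x) x) = mul x x ∧
      ∀ y : X, mul x (div y x) = y → y = mul x x := by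
  refine ⟨by rw [hmd], fun y hy => ?_⟩
  -- Since `x` and `z = y/x` commute, the identity forces `x·x = x·z`, which is `y`.
  have h := rump x (div y x) x
  rw [hdm, hy] at h
  simpa only [hmd] using (congrArg (div · y) h).symm
end

section
/- Let (X,·) be a Rump right quasigroup, let R(x,y) = (y·(x/y), x/y) be the associated Yang–Baxter solution, and for n ≥ 1 let C_n^{YB}(X) be the free abelian group on n-tuples of elements of X with boundary ∂_n^{YB} = Σ_{i=1}^n (−1)^{i+1}(d_{i,n}^l − d_{i,n}^r), where d_{i,n}^l = (μ × Id^{n−2}) ∘ (Id × R × Id^{n−3}) ∘ ⋯ ∘ (Id^{i−2} × R × Id^{n−i}) and d_{i,n}^r = (Id^{n−2} × ν) ∘ (Id^{n−3} × R × Id) ∘ ⋯ ∘ (Id^{i−1} × R × Id^{n−i−1}) with μ(x,y) = R₂(x,y) and ν(x,y) = R₁(x,y). Let C_n^D(X) ⊆ C_n^{YB}(X) be the subgroup spanned by all tuples (x₁,…,x_{i−1}, x_i·x_i, x_i, x_{i+1},…,x_{n−1}) for 1 ≤ i ≤ n−1 (and C_n^D(X) = 0 for n ≤ 1). Then ∂_n^{YB}(C_n^D(X))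 ⊆ C_{n−1}^D(X), i.e., the degenerate chain groups form a sub-chain complex of the set-theoretic Yang–Baxter chain complex. -/
/-- The `n`-th chain group of the set-theoretic Yang-Baxter chain complex:
the free abelian group generated by `n`-tuples of elements of `X`. -/
abbrev CYB (X : Type*) (n : ℕ) : Type _ := (Fin n → X) →₀ ℤ

/-- Apply `R` to the entries in positions `(j, j+1)` (0-indexed) of a tuple. -/
def rapp {X : Type*} (R : X × X → X × X) {n : ℕ} (j : ℕ) (v : Fin n → X) : Fin n → X :=
  fun k =>
    if hj : j + 1 < n then
      if k.val = j then (R (v ⟨j, Nat.lt_of_succ_lt hj⟩, v ⟨j + 1, hj⟩)).1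
      else if k.val = j + 1 then (R (v ⟨j, Nat.lt_of_succ_lt hj⟩, v ⟨j + 1, hj⟩)).2
      else v k
    else v k

/-- `leftIter R m` applies `R` at positions `(m, m+1), (m−1, m), …, (1, 2)`
(0-indexed), i.e. it is `rapp 1 ∘ rapp 2 ∘ ⋯ ∘ rapp m`. -/
def leftIter {X : Type*} (R : X × X → X × X) {n : ℕ} : ℕ → (Fin n → X) → (Fin n → X)
  | 0, v => v
  | m + 1, v => leftIter R m (rapp R (m + 1) v)

/-- `rightIter R c j` applies `R` at positions `(j, j+1), (j+1, j+2), …,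
(j+c−1, j+c)` (0-indexed), in this order. -/
def rightIter {X : Type*} (R : X × X → X × X) {n : ℕ} : ℕ → ℕ → (Fin n → X) → (Fin n → X)
  | 0, _, v => v
  | c + 1, j, v => rightIter R c (j + 1) (rapp R j v)

/-- The left face map `d_{i+1,n+1}^l` (`i` is 0-indexed here, so `i = 0`
corresponds to the paper's `i = 1`):
`d_{i,n}^l = (μ × Id^{n−2}) ∘ (Id × R × Id^{n−3}) ∘ ⋯ ∘ (Id^{i−2} × R × Id^{n−i})`
with `μ = R₂`. -/
def faceL {X : Type*} (R : X × X → X × X) {n : ℕ} (i : ℕ) (v : Fin (n + 1) → X) :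
    Fin n → X :=
  if i = 0 then fun k => v k.succ
  else fun k =>
    let u := leftIter R (i - 1) v
    if k.val = 0 then (R (u 0, u 1)).2 else u k.succ

/-- The right face map `d_{i+1,n+1}^r` (`i` is 0-indexed here):
`d_{i,n}^r = (Id^{n−2} × ν) ∘ (Id^{n−3} × R × Id) ∘ ⋯ ∘ (Id^{i−1} × R × Id^{n−i−1})`
with `ν = R₁`. -/
def faceR {X : Type*} (R : X × X → X × X) {n : ℕ} (i : ℕ) (v : Fin (n + 1) → X) :
    Fin n → X :=
  if i = n then fun k => v k.castSucc
  else fun k =>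
    let u := rightIter R (n - 1 - i) i v
    if k.val = n - 1 then (R (u ⟨n - 1, by omega⟩, u ⟨n, by omega⟩)).1
    else u k.castSucc

/-- The Yang-Baxter boundary map
`∂_{n+1}^{YB} = Σ_{i=1}^{n+1} (−1)^{i+1} (d_{i,n+1}^l − d_{i,n+1}^r) :
C_{n+1}^{YB}(X) → C_n^{YB}(X)`. -/
noncomputable def boundary {X : Type*} (R : X × X → X × X) (n : ℕ) : CYB X (n + 1) →+ CYB X n :=
  ∑ i ∈ Finset.range (n + 1),
    ((-1 : ℤ) ^ i) •
      (Finsupp.mapDomain.addMonoidHom (faceL R i) -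
        Finsupp.mapDomain.addMonoidHom (faceR R i))

/-- The degenerate subgroup `C_n^D(X) ⊆ C_n^{YB}(X)`, spanned by all tuples of
the form `(x₁, …, x_{i−1}, x_i·x_i, x_i, x_{i+1}, …, x_{n−1})`. -/
noncomputable def degen {X : Type*} (mul : X → X → X) (n : ℕ) : AddSubgroup (CYB X n) :=
  AddSubgroup.closure
    {f | ∃ (j : ℕ) (hj : j + 1 < n) (v : Fin n → X),
      v ⟨j, Nat.lt_of_succ_lt hj⟩ = mul (v ⟨j + 1, hj⟩) (v ⟨j + 1, hj⟩) ∧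
      f = Finsupp.single v 1}

section Positions

variable {X : Type*} (R : X × X → X × X) {n : ℕ}

lemma rapp_of_ne {j : ℕ} (v : Fin n → X) {k : Fin n} (h : k.val ≠ j) (h' : k.val ≠ j + 1) :
    rapp R j v k = v k := by
  simp [rapp, h, h']

lemma rapp_left (v : Fin n → X) {a b : Fin n} (h : b.val = a.val + 1) :
    rapp R a.val v a = (R (v a, v b)).1 := by
  obtain ⟨b, hb⟩ := b
  subst h
  simp [rapp, hb]

lemma rapp_right (v : Fin n → X) {a b : Fin n} (h : b.val = a.val + 1) :
    rapp R a.val v b = (R (v a, v b)).2 := by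
  obtain ⟨b, hb⟩ := b
  subst h
  simp [rapp, hb]

/-- `leftPass R m` is `rapp 0 ∘ rapp 1 ∘ ⋯ ∘ rapp (m - 1)`: it moves the strand at position `m`
to position `0`. -/
def leftPass : ℕ → (Fin n → X) → (Fin n → X)
  | 0, v => v
  | m + 1, v => leftPass m (rapp R m v)

lemma leftPass_succ_eq_rapp_leftIter (m : ℕ) (v : Fin n → X) :
    leftPass R (m + 1) v = rapp R 0 (leftIter R m v) := by
  induction m generalizing v with
  | zero => rfl
  | succ m ih => exact ih _

lemma rightIter_succ_eq_rapp (c j : ℕ) (v : Fin n → X) :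
    rightIter R (c + 1) j v = rapp R (j + c) (rightIter R c j v) := by
  induction c generalizing j v with
  | zero => rfl
  | succ c ih =>
    rw [rightIter, ih, rightIter, Nat.add_right_comm, Nat.add_assoc]

lemma faceL_eq (i : ℕ) (hi : i ≤ n) (v : Fin (n + 1) → X) :
    faceL R i v = fun k => leftPass R i v k.succ := by
  cases i with
  | zero => rfl
  | succ m =>
    obtain ⟨n, rfl⟩ : ∃ n', n = n' + 1 := ⟨n - 1, by omega⟩
    funext k
    rw [leftPass_succ_eq_rapp_leftIter]
    by_cases hk : k.val = 0
    · obtain rfl : k = 0 := Fin.ext hk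
      simpa [faceL] using
        (rapp_right R (leftIter R m v) (a := 0) (b := 1) (by simp)).symm
    · simp [faceL, hk, rapp_of_ne R _ (k := k.succ) (j := 0) (by simp) (by simpa using hk)]

lemma faceR_eq (i : ℕ) (hi : i ≤ n) (v : Fin (n + 1) → X) :
    faceR R i v = fun k => rightIter R (n - i) i v k.castSucc := by
  rcases hi.eq_or_lt with rfl | hi
  · simp [faceR, rightIter]
  · funext k
    obtain ⟨c, rfl⟩ : ∃ c, n = i + c + 1 := ⟨n - i - 1, by omega⟩
    rw [show i + c + 1 - i = c + 1 by omega, rightIter_succ_eq_rapp]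
    have hc : i + c + 1 - 1 - i = c := by omega
    by_cases hk : k.val = i + c
    · have hk' : k = ⟨i + c, by omega⟩ := Fin.ext hk
      have := rapp_left R (rightIter R c i v) (a := ⟨i + c, by omega⟩)
        (b := ⟨i + c + 1, by omega⟩) rfl
      simpa [faceR, hi.ne, hc, hk'] using this.symm
    · rw [rapp_of_ne R _ (by simpa using hk) (by have := k.isLt; simp; omega)]
      simp [faceR, hi.ne, hk]

lemma leftPass_of_lt (m : ℕ) (v : Fin n → X) {k : Fin n} (h : m < k.val) :
    leftPass R m v k = v k := by
  induction m generalizing v with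
  | zero => rfl
  | succ m ih => rw [leftPass, ih _ (by omega), rapp_of_ne R _ (by omega) (by omega)]

lemma rightIter_of_lt (c j : ℕ) (v : Fin n → X) {k : Fin n} (h : k.val < j) :
    rightIter R c j v k = v k := by
  induction c generalizing j v with
  | zero => rfl
  | succ c ih => rw [rightIter, ih _ _ (by omega), rapp_of_ne R _ (by omega) (by omega)]

end Positions

/-- The tuple `v` is degenerate at positions `(j, j + 1)` (0-indexed). -/
def DegenerateAt {X : Type*} (mul : X → X → X) {n : ℕ} (j : ℕ) (v : Fin n → X) : Prop :=
  ∀ a b : Fin n, a.val = j → b.val = j + 1 → v a = mul (v b) (v b)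

namespace DegenerateAt

variable {X : Type*} {mul : X → X → X} {R : X × X → X × X} {n j : ℕ}

lemma congr {v w : Fin n → X} (hv : DegenerateAt mul j v)
    (h : ∀ k : Fin n, k.val = j ∨ k.val = j + 1 → w k = v k) : DegenerateAt mul j w := by
  intro a b ha hb
  rw [h a (.inl ha), h b (.inr hb)]
  exact hv a b ha hb

lemma single_mem_degen {v : Fin n → X} (hv : DegenerateAt mul j v) (hj : j + 1 < n) :
    Finsupp.single v 1 ∈ degen mul n :=
  AddSubgroup.subset_closure ⟨j, hj, v, hv _ _ rfl rfl, rfl⟩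

lemma comp_succ {v : Fin (n + 1) → X} (hv : DegenerateAt mul (j + 1) v) :
    DegenerateAt mul j fun k : Fin n => v k.succ :=
  fun a b ha hb => hv a.succ b.succ (by simp [ha]) (by simp [hb])

lemma comp_castSucc {v : Fin (n + 1) → X} (hv : DegenerateAt mul j v) :
    DegenerateAt mul j fun k : Fin n => v k.castSucc :=
  fun a b ha hb => hv a.castSucc b.castSucc (by simp [ha]) (by simp [hb])

lemma rapp_eq (hR : ∀ x, R (mul x x, x) = (mul x x, x)) {v : Fin n → X}
    (hv : DegenerateAt mul j v) : rapp R j v = v := by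
  funext k
  by_cases hj : j + 1 < n
  · have h := hv ⟨j, by omega⟩ ⟨j + 1, hj⟩ rfl rfl
    by_cases hk : k.val = j
    · simp [rapp, hj, h, hR, (Fin.ext hk : k = ⟨j, by omega⟩)]
    · by_cases hk' : k.val = j + 1
      · simp [rapp, hj, h, hR, (Fin.ext hk' : k = ⟨j + 1, hj⟩)]
      · exact rapp_of_ne R v hk hk'
  · simp [rapp, hj]

lemma leftPass
    (hR : ∀ x z, (R (mul x x, (R (x, z)).1)).2 = mul (R (x, z)).2 (R (x, z)).2)
    {v : Fin n → X} (hv : DegenerateAt mul j v) (m : ℕ) :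
    DegenerateAt mul (j + 1) (leftPass R (j + 2 + m) v) := by
  induction m generalizing v with
  | zero =>
    intro a b ha hb
    let c : Fin n := ⟨j, by omega⟩
    have hc : c.val = j := rfl
    have hb₁ := rapp_right R v (a := a) (b := b) (by omega)
    have ha₁ := rapp_left R v (a := a) (b := b) (by omega)
    have ha₂ := rapp_right R (rapp R (j + 1) v) (a := c) (b := a) (by omega)
    rw [ha] at hb₁ ha₁
    rw [hc, ha₁, rapp_of_ne R v (by omega) (by omega), hv c a hc ha] at ha₂
    simp only [_root_.leftPass]
    rw [leftPass_of_lt R j _ (by omega), leftPass_of_lt R j _ (by omega), ha₂,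
      rapp_of_ne R _ (j := j) (k := b) (by omega) (by omega), hb₁, hR]
  | succ m ih =>
    exact ih (v := rapp R (j + 2 + m) v)
      (hv.congr fun k hk => rapp_of_ne R v (by omega) (by omega))

lemma rightIter
    (hR : ∀ w x, (R (w, mul x x)).1 =
      mul (R ((R (w, mul x x)).2, x)).1 (R ((R (w, mul x x)).2, x)).1)
    {v : Fin n → X} (m i c : ℕ) (hn : i + m + 2 < n) (hv : DegenerateAt mul (i + m + 1) v) :
    DegenerateAt mul (i + m) (rightIter R (m + 2 + c) i v) := by
  induction m generalizing i v with
  | zero =>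
    intro a b ha hb
    let d : Fin n := ⟨i + 2, hn⟩
    have hd : d.val = i + 2 := rfl
    have ha₁ := rapp_left R v (a := a) (b := b) (by omega)
    have hb₁ := rapp_right R v (a := a) (b := b) (by omega)
    have hb₂ := rapp_left R (rapp R i v) (a := b) (b := d) (by omega)
    have hbd := hv b d (by omega) (by omega)
    simp only [Nat.add_zero] at ha hb
    rw [ha, hbd] at ha₁ hb₁
    rw [hb, hb₁, rapp_of_ne R v (by omega) (by omega)] at hb₂
    rw [show 0 + 2 + c = c + 1 + 1 by omega]
    simp only [_root_.rightIter]
    rw [rightIter_of_lt R c _ _ (by omega), rightIter_of_lt R c _ _ (by omega), hb₂,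
      rapp_of_ne R _ (k := a) (by omega) (by omega), ha₁]
    exact hR _ _
  | succ m ih =>
    rw [show m + 1 + 2 + c = m + 2 + c + 1 by omega, show i + (m + 1) = i + 1 + m by omega]
    exact ih (i + 1) (by omega) ((show i + (m + 1) + 1 = i + 1 + m + 1 by omega) ▸ hv.congr
      fun k hk => rapp_of_ne R v (by omega) (by omega))

lemma faceL_succ (hR : ∀ x, R (mul x x, x) = (mul x x, x)) {v : Fin (n + 1) → X}
    (hv : DegenerateAt mul j v) (hj : j + 1 ≤ n) : faceL R (j + 1) v = faceL R j v := by
  rw [faceL_eq R _ hj, faceL_eq R _ (by omega), _root_.leftPass, hv.rapp_eq hR]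

lemma faceR_succ (hR : ∀ x, R (mul x x, x) = (mul x x, x)) {v : Fin (n + 1) → X}
    (hv : DegenerateAt mul j v) (hj : j + 1 ≤ n) : faceR R (j + 1) v = faceR R j v := by
  rw [faceR_eq R _ hj, faceR_eq R j (by omega), show n - j = n - (j + 1) + 1 by omega,
    _root_.rightIter, hv.rapp_eq hR]

lemma single_faceL_mem_degen
    (hR : ∀ x z, (R (mul x x, (R (x, z)).1)).2 = mul (R (x, z)).2 (R (x, z)).2)
    {v : Fin (n + 1) → X} (hv : DegenerateAt mul j v) (hj : j + 1 ≤ n) {i : ℕ} (hi : i ≤ n)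
    (hij : i ≠ j) (hij' : i ≠ j + 1) : Finsupp.single (faceL R i v) 1 ∈ degen mul n := by
  rw [faceL_eq R i hi]
  rcases hij.lt_or_gt with h | h
  · obtain ⟨j, rfl⟩ : ∃ j', j = j' + 1 := ⟨j - 1, by omega⟩
    exact (hv.congr fun k hk => leftPass_of_lt R i v (by omega)).comp_succ.single_mem_degen (by omega)
  · obtain ⟨m, rfl⟩ : ∃ m, i = j + 2 + m := ⟨i - (j + 2), by omega⟩
    exact (hv.leftPass hR m).comp_succ.single_mem_degen (by omega)

lemma single_faceR_mem_degen
    (hR : ∀ w x, (R (w, mul x x)).1 =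
      mul (R ((R (w, mul x x)).2, x)).1 (R ((R (w, mul x x)).2, x)).1)
    {v : Fin (n + 1) → X} (hv : DegenerateAt mul j v) (hj : j + 1 ≤ n) {i : ℕ} (hi : i ≤ n)
    (hij : i ≠ j) (hij' : i ≠ j + 1) : Finsupp.single (faceR R i v) 1 ∈ degen mul n := by
  rw [faceR_eq R i hi]
  rcases hij.lt_or_gt with h | h
  · obtain ⟨m, rfl⟩ : ∃ m, j = i + m + 1 := ⟨j - i - 1, by omega⟩
    rw [show n - i = m + 2 + (n - i - m - 2) by omega]
    exact (rightIter hR m i _ (by omega) hv).comp_castSucc.single_mem_degen (by omega)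
  · exact (hv.congr fun k hk => rightIter_of_lt R _ i v (by omega)).comp_castSucc.single_mem_degen
      (by omega)

end DegenerateAt

lemma AddSubgroup.alternating_sum_mem {A : Type*} [AddCommGroup A] (S : AddSubgroup A) {n j : ℕ}
    (hj : j + 1 < n) (f : ℕ → A) (hf : f (j + 1) = f j)
    (hS : ∀ i < n, i ≠ j → i ≠ j + 1 → f i ∈ S) :
    ∑ i ∈ Finset.range n, (-1 : ℤ) ^ i • f i ∈ S := by
  rw [← Finset.add_sum_erase _ _ (Finset.mem_range.2 (by omega : j < n)),
    ← Finset.add_sum_erase _ _ (Finset.mem_erase.2 ⟨j.succ_ne_self, Finset.mem_range.2 hj⟩),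
    hf, pow_succ, mul_neg_one, neg_smul, add_neg_cancel_left]
  refine S.sum_mem fun i hi => S.zsmul_mem ?_ _
  simp only [Finset.mem_erase, Finset.mem_range] at hi
  exact hS i hi.2.2 hi.2.1 hi.1

lemma boundary_single {X : Type*} (R : X × X → X × X) (n : ℕ) (v : Fin (n + 1) → X) :
    boundary R n (Finsupp.single v 1) = ∑ i ∈ Finset.range (n + 1),
      (-1 : ℤ) ^ i • (Finsupp.single (faceL R i v) 1 - Finsupp.single (faceR R i v) 1) := by
  simp [boundary, AddMonoidHom.finsetSum_apply, Finsupp.mapDomain_single]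

/-- For a Rump right quasigroup `(X, mul)` with associated Yang-Baxter solution
`R(x,y) = (y·(x/y), x/y)`, the Yang-Baxter boundary maps the degenerate
subgroup `C_{n+1}^D(X)` into `C_n^D(X)`: the degenerate chain groups form a
sub-chain complex of the set-theoretic Yang-Baxter chain complex. -/
theorem stmt15 {X : Type*} (mul div : X → X → X)
    (hdm : ∀ x y, mul (div x y) y = x) (hmd : ∀ x y, div (mul x y) y = x)
    (rump : ∀ x y z, mul (mul z x) (mul y x) = mul (mul z y) (mul x y))
    (n : ℕ) (c : CYB X (n + 1)) (hc : c ∈ degen mul (n + 1)) :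
    boundary (fun p : X × X => (mul p.2 (div p.1 p.2), div p.1 p.2)) n c ∈ degen mul n := by
  have hfix : ∀ x, (mul x (div (mul x x) x), div (mul x x) x) = (mul x x, x) := fun x => by
    rw [hmd]
  have hleft : ∀ x z, div (mul x x) (mul z (div x z)) = mul (div x z) (div x z) := fun x z => by
    have h := rump (div x z) z (div x z)
    rw [hdm] at h
    rw [← h, hmd]
  have hright : ∀ w x, mul (mul x x) (div w (mul x x)) =
      mul (mul x (div (div w (mul x x)) x)) (mul x (div (div w (mul x x)) x)) := fun w x => by
    have h := rump x (div (div w (mul x x)) x) x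
    rwa [hdm] at h
  induction hc using AddSubgroup.closure_induction with
  | mem c hc =>
    obtain ⟨j, hj, v, hv, rfl⟩ := hc
    have hv' : DegenerateAt mul j v := by
      rintro ⟨a, _⟩ ⟨b, _⟩ rfl rfl
      exact hv
    rw [boundary_single]
    refine AddSubgroup.alternating_sum_mem _ hj _ ?_ fun i hi hij hij' => sub_mem ?_ ?_
    · rw [hv'.faceL_succ hfix (by omega), hv'.faceR_succ hfix (by omega)]
    · exact hv'.single_faceL_mem_degen hleft (by omega) (by omega) hij hij'
    · exact hv'.single_faceR_mem_degen hright (by omega) (by omega) hij hij'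
  | zero => simp
  | add x y _ _ hx hy => simpa using add_mem hx hy
  | neg x _ hx => simpa using hx
end

section
/- Let X be the cyclic rack of order m (ℤ/mℤ with operation i·j = i+1), and let κ_n : C_n^{YB}(X) → C_n^{YB}(X) be the homomorphism determined on generators by κ_n(x₁,…,x_n) = (x₁ − x₂·x₂) ⊗ (x₂ − x₃·x₃) ⊗ ⋯ ⊗ (x_{n−1} − x_n·x_n) ⊗ x_n, expanded multilinearly in the free abelian group C_n^{YB}(X) (here x·x = x+1). Then κ is a chain map: ∂_n^{YB} ∘ κ_n = κ_{n−1} ∘ ∂_n^{YB} for all n ≥ 2, where ∂^{YB} is the Yang–Baxter boundary associated to the solution R(x,y) = (y+1, x−1). -/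
/-- The value of `κ_n` on a generator `(x₁, …, x_n)`: the multilinear expansion
of `(x₁ − x₂·x₂) ⊗ (x₂ − x₃·x₃) ⊗ ⋯ ⊗ (x_{n−1} − x_n·x_n) ⊗ x_n`, a signed sum
over the subsets `s` of positions where the term `x_{i+1}·x_{i+1}` is chosen. -/
noncomputable def kappaGen {X : Type*} (mul : X → X → X) {n : ℕ} (v : Fin n → X) :
    CYB X n :=
  ∑ s ∈ (Finset.univ.filter fun i : Fin n => i.val + 1 < n).powerset,
    ((-1 : ℤ) ^ s.card) •
      Finsupp.single
        (fun i : Fin n =>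
          if h : i ∈ s ∧ i.val + 1 < n then
            mul (v ⟨i.val + 1, h.2⟩) (v ⟨i.val + 1, h.2⟩)
          else v i) 1

/-- The homomorphism `κ_n : C_n^{YB}(X) → C_n^{YB}(X)` determined on
generators by `κ_n(x₁,…,x_n) = (x₁ − x₂·x₂) ⊗ ⋯ ⊗ (x_{n−1} − x_n·x_n) ⊗ x_n`. -/
noncomputable def kappa {X : Type*} (mul : X → X → X) (n : ℕ) : CYB X n →+ CYB X n :=
  Finsupp.liftAddHom fun v => (zmultiplesHom _) (kappaGen mul v)

/-- The face map deleting the entry at position `i`, adding `a - 1` to the entries before it and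
`a` to the entries after it. For `a = 0` and `a = 1` these are the left and right faces of the
cyclic rack. -/
def shiftFace {m : ℕ} (a : ZMod m) {k : ℕ} (i : Fin (k + 1)) (v : Fin (k + 1) → ZMod m) :
    Fin k → ZMod m :=
  fun j => v (i.succAbove j) + if j.castSucc < i then a - 1 else a

lemma leftIter_zero_apply {m : ℕ} (c : ℕ) {n : ℕ} (v : Fin n → ZMod m) (hn : 0 < n) :
    leftIter (fun p : ZMod m × ZMod m => (p.2 + 1, p.1 - 1)) c v ⟨0, hn⟩ = v ⟨0, hn⟩ := by
  induction c generalizing v with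
  | zero => rfl
  | succ c ih =>
    rw [leftIter, ih]
    simp [rapp]

lemma leftIter_add_two_apply {m : ℕ} (c : ℕ) {n : ℕ} (v : Fin n → ZMod m) (hc : c + 1 < n)
    (j : ℕ) (hj : j + 2 < n) :
    leftIter (fun p : ZMod m × ZMod m => (p.2 + 1, p.1 - 1)) c v ⟨j + 2, hj⟩ =
      if j + 1 ≤ c then v ⟨j + 1, by omega⟩ - 1 else v ⟨j + 2, hj⟩ := by
  induction c generalizing v with
  | zero => simp [leftIter]
  | succ c ih =>
    rw [leftIter, ih _ (by omega)]
    rcases lt_trichotomy j c with h | rfl | h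
    · have h1 : j ≠ c := by omega
      have h2 : j ≠ c + 1 := by omega
      have h3 : j + 1 ≤ c := by omega
      have h4 : j ≤ c := by omega
      simp [rapp, h1, h2, h3, h4]
    · simp [rapp, hc]
    · have h1 : j ≠ c := by omega
      have h2 : j + 1 ≠ c := by omega
      have h3 : ¬ j + 1 ≤ c := by omega
      have h4 : ¬ j ≤ c := by omega
      simp [rapp, h1, h2, h3, h4]

lemma rightIter_apply {m : ℕ} (c j : ℕ) {n : ℕ} (v : Fin n → ZMod m) (hc : j + c < n)
    (l : ℕ) (hl : l < n) (hlc : l ≠ j + c) :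
    rightIter (fun p : ZMod m × ZMod m => (p.2 + 1, p.1 - 1)) c j v ⟨l, hl⟩ =
      if h : j ≤ l ∧ l < j + c then v ⟨l + 1, by omega⟩ + 1 else v ⟨l, hl⟩ := by
  induction c generalizing v j with
  | zero =>
    rw [dif_neg (by omega)]
    rfl
  | succ c ih =>
    rw [rightIter, ih (j + 1) _ (by omega) (by omega)]
    have h0 : j + 1 < n := by omega
    by_cases h1 : j + 1 ≤ l ∧ l < j + 1 + c
    · have h2 : j ≤ l ∧ l < j + (c + 1) := by omega
      have h3 : l + 1 ≠ j := by omega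
      have h4 : l ≠ j := by omega
      rw [dif_pos h1, dif_pos h2]
      simp [rapp, h3, h4]
    · rw [dif_neg h1]
      rcases eq_or_ne l j with rfl | h4
      · rw [dif_pos (by omega)]
        simp [rapp, h0]
      · rw [dif_neg (by omega)]
        have h5 : l ≠ j + 1 := by omega
        simp [rapp, h4, h5]

lemma faceL_eq_shiftFace {m k : ℕ} (i : Fin (k + 1)) :
    faceL (fun p : ZMod m × ZMod m => (p.2 + 1, p.1 - 1)) (i : ℕ) = shiftFace 0 i := by
  funext v ⟨j, hj⟩
  obtain ⟨i, hi⟩ := i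
  rcases Nat.eq_zero_or_pos i with rfl | hpos
  · simp [faceL, shiftFace, Fin.succAbove]
  · rcases j with _ | j
    · have := leftIter_zero_apply (i - 1) v (Nat.succ_pos k)
      simp only [Fin.mk_zero'] at this
      simp [faceL, shiftFace, Fin.succAbove, Fin.lt_def, hpos.ne', hpos, this,
        ← sub_eq_add_neg]
    · have := leftIter_add_two_apply (i - 1) v (by omega) j (by omega)
      simp only [faceL, hpos.ne', if_false, Fin.succ_mk, Nat.succ_ne_zero]
      rw [this]
      by_cases h : j + 1 < i
      · have h' : j + 1 ≤ i - 1 := by omega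
        simp [shiftFace, Fin.succAbove, Fin.lt_def, h, h', sub_eq_add_neg]
      · have h' : ¬ j + 1 ≤ i - 1 := by omega
        simp [shiftFace, Fin.succAbove, Fin.lt_def, h, h']

lemma faceR_eq_shiftFace {m k : ℕ} (i : Fin (k + 1)) :
    faceR (fun p : ZMod m × ZMod m => (p.2 + 1, p.1 - 1)) (i : ℕ) = shiftFace 1 i := by
  funext v ⟨j, hj⟩
  obtain ⟨i, hi⟩ := i
  by_cases hik : i = k
  · subst hik
    simp [faceR, shiftFace, Fin.succAbove, Fin.lt_def, hj]
  · simp only [faceR, hik, if_false]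
    by_cases hjk : j = k - 1
    · have h1 : ¬ j < i := by omega
      have h2 : j + 1 = k := by omega
      rw [if_pos hjk, rightIter_apply _ _ _ (by omega) _ _ (by omega), dif_neg (by omega)]
      simp [shiftFace, Fin.succAbove, Fin.lt_def, h1, h2]
    · rw [if_neg hjk, Fin.castSucc_mk, rightIter_apply _ _ _ (by omega) _ _ (by omega)]
      by_cases h : j < i
      · rw [dif_neg (by omega)]
        simp [shiftFace, Fin.succAbove, Fin.lt_def, h]
      · rw [dif_pos (by omega)]
        simp [shiftFace, Fin.succAbove, Fin.lt_def, h]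

/-- The coefficient at `x` of the tensor factor of `κ(v)` in position `j`. -/
def kappaFactor {m n : ℕ} (v : Fin n → ZMod m) (j : Fin n) (x : ZMod m) : ℤ :=
  (if v j = x then 1 else 0) -
    if h : j.val + 1 < n then (if v ⟨j.val + 1, h⟩ + 1 = x then 1 else 0) else 0

lemma kappaGen_apply {m n : ℕ} (v w : Fin n → ZMod m) :
    kappaGen (fun i _ : ZMod m => i + 1) v w = ∏ j, kappaFactor v j (w j) := by
  set q : Fin n → ℤ := fun j =>
    if h : j.val + 1 < n then (if v ⟨j.val + 1, h⟩ + 1 = w j then 1 else 0) else 0 with hq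
  have hprod : ∏ j, kappaFactor v j (w j) =
      ∑ s : Finset (Fin n), (-1 : ℤ) ^ s.card *
        ∏ j, if j ∈ s then q j else if v j = w j then 1 else 0 := by
    have h1 : ∀ j, kappaFactor v j (w j) = -q j + if v j = w j then 1 else 0 := by
      intro j
      simp only [kappaFactor, hq]
      ring
    simp only [h1]
    rw [Finset.prod_add, Finset.powerset_univ]
    refine Finset.sum_congr rfl fun s _ => ?_
    rw [Finset.prod_neg, mul_assoc,
      Finset.prod_ite (s := Finset.univ) (p := (· ∈ s)), Finset.filter_univ_mem,
      Finset.filter_notMem_eq_sdiff]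
  rw [hprod, kappaGen, Finsupp.finsetSum_apply]
  rw [← Finset.sum_subset (Finset.subset_univ
    (Finset.univ.filter fun i : Fin n => i.val + 1 < n).powerset)]
  · refine Finset.sum_congr rfl fun s hs => ?_
    have hfactor (j : Fin n) : (if j ∈ s then q j else if v j = w j then 1 else 0) =
        if (if h : j ∈ s ∧ j.val + 1 < n then v ⟨j.val + 1, h.2⟩ + 1 else v j) = w j
          then 1 else 0 := by
      by_cases hj : j ∈ s
      · have hjn : j.val + 1 < n := by simpa using Finset.mem_powerset.1 hs hj
        simp [hj, hjn, hq]
      · simp [hj]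
    simp only [hfactor, Fintype.prod_boole, Finsupp.smul_apply, smul_eq_mul,
      Finsupp.single_apply, funext_iff]
    congr
  · intro s _ hs
    simp only [Finset.mem_powerset, Finset.not_subset, Finset.mem_filter, Finset.mem_univ,
      true_and] at hs
    obtain ⟨j, hj, hjn⟩ := hs
    rw [Finset.prod_eq_zero (Finset.mem_univ j) (by simp [hj, hq, hjn]), mul_zero]

lemma sum_kappaFactor {m k : ℕ} [NeZero m] (v : Fin (k + 1) → ZMod m) (i : Fin (k + 1)) :
    ∑ x, kappaFactor v i x = if i = Fin.last k then 1 else 0 := by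
  have h : i = Fin.last k ↔ ¬ i.val < k := by
    rw [Fin.ext_iff, Fin.val_last]; omega
  by_cases hi : i.val < k <;> simp [kappaFactor, Finset.sum_sub_distrib, h, hi]

lemma mapDomain_shiftFace_apply {m k : ℕ} [NeZero m] (a : ZMod m) (i : Fin (k + 1))
    (c : CYB (ZMod m) (k + 1)) (y : Fin (k + 1) → ZMod m → ℤ) (hc : ∀ v, c v = ∏ j, y j (v j))
    (w : Fin k → ZMod m) :
    Finsupp.mapDomain (shiftFace a i) c w = (∑ x, y i x) *
      ∏ j : Fin k, y (i.succAbove j) (w j - if j.castSucc < i then a - 1 else a) := by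
  rw [Finsupp.mapDomain, Finsupp.sum_fintype _ _ (by simp), Finsupp.finsetSum_apply]
  simp only [Finsupp.single_apply, hc]
  rw [← (Fin.insertNthEquiv (fun _ => ZMod m) i).sum_comp, Fintype.sum_prod_type, Finset.sum_mul]
  refine Finset.sum_congr rfl fun x _ => ?_
  rw [Finset.sum_eq_single fun j => w j - if j.castSucc < i then a - 1 else a]
  · rw [if_pos (by funext j; simp [shiftFace]), Fin.prod_univ_succAbove _ i]
    simp
  · intro u _ hu
    rw [if_neg]
    rintro rfl
    exact hu (by funext j; simp [shiftFace])
  · simp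

lemma kappaFactor_shiftFace_prod {m k : ℕ} (a : ZMod m) (v : Fin (k + 1) → ZMod m)
    (w : Fin k → ZMod m) (p : Fin k) :
    ∏ j, kappaFactor (shiftFace a p.succ v) j (w j) =
      (∏ j, kappaFactor v (p.succ.succAbove j)
          (w j - if j.castSucc < p.succ then a - 1 else a)) +
        ∏ j, kappaFactor v (p.castSucc.succAbove j)
          (w j - if j.castSucc < p.castSucc then a - 1 else a) := by
  have e1 (x : ZMod m) : x + (a - 1) + 1 = x + a := by ring
  have e2 (x : ZMod m) : x + 1 + a = x + a + 1 := by ring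
  symm
  obtain ⟨p, hp⟩ := p
  refine Finset.prod_add_prod_eq (Finset.mem_univ ⟨p, hp⟩) ?_ ?_ ?_
  · simp [kappaFactor, shiftFace, Fin.succAbove, Fin.lt_def, hp, eq_sub_iff_add_eq, e2]
  all_goals
    rintro ⟨j, hj⟩ - hne
    have hne' : j ≠ p := by simpa using hne
    rcases lt_or_gt_of_ne hne' with h | h
    · have h1 : j < p + 1 := by omega
      have h2 : j + 1 < k := by omega
      simp [kappaFactor, shiftFace, Fin.succAbove, Fin.lt_def, h, h1, h2, hj, eq_sub_iff_add_eq,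
        e1]
    · have h1 : ¬ j < p + 1 := by omega
      have h2 : ¬ j < p := by omega
      simp [kappaFactor, shiftFace, Fin.succAbove, Fin.lt_def, h1, h2, eq_sub_iff_add_eq, e2]

lemma kappaFactor_shiftFace_zero_prod {m k : ℕ} (a : ZMod m) (v : Fin (k + 1) → ZMod m)
    (w : Fin k → ZMod m) :
    ∏ j, kappaFactor (shiftFace a 0 v) j (w j) =
      ∏ j, kappaFactor v ((0 : Fin (k + 1)).succAbove j)
        (w j - if j.castSucc < (0 : Fin (k + 1)) then a - 1 else a) := by
  refine Finset.prod_congr rfl fun j _ => ?_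
  simp [kappaFactor, shiftFace, eq_sub_iff_add_eq, add_right_comm]

lemma sum_alternating_telescope {k : ℕ} (P A : Fin (k + 1) → ℤ) (h0 : P 0 = A 0)
    (hs : ∀ p : Fin k, P p.succ = A p.succ + A p.castSucc) :
    ∑ i : Fin (k + 1), (-1 : ℤ) ^ i.val * P i = (-1) ^ k * A (Fin.last k) := by
  induction k with
  | zero => simp [h0]
  | succ k ih =>
    have := ih (fun i => P i.castSucc) (fun i => A i.castSucc) h0
      (fun p => hs p.castSucc)
    rw [Fin.sum_univ_castSucc, ← Fin.succ_last, hs]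
    simp only [Fin.val_castSucc, Fin.val_succ, Fin.val_last] at this ⊢
    rw [this]
    ring

lemma sum_mapDomain_shiftFace_kappaGen {m k : ℕ} [NeZero m] (a : ZMod m)
    (v : Fin (k + 1) → ZMod m) :
    ∑ i : Fin (k + 1), (-1 : ℤ) ^ i.val •
        Finsupp.mapDomain (shiftFace a i) (kappaGen (fun i _ : ZMod m => i + 1) v) =
      ∑ i : Fin (k + 1), (-1 : ℤ) ^ i.val •
        kappaGen (fun i _ : ZMod m => i + 1) (shiftFace a i v) := by
  ext w
  simp only [Finsupp.finsetSum_apply, Finsupp.smul_apply, smul_eq_mul, kappaGen_apply]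
  rw [sum_alternating_telescope (fun i => ∏ j, kappaFactor (shiftFace a i v) j (w j))
    (fun i => ∏ j, kappaFactor v (i.succAbove j) (w j - if j.castSucc < i then a - 1 else a))
    (kappaFactor_shiftFace_zero_prod a v w)
    (kappaFactor_shiftFace_prod a v w)]
  simp only [mapDomain_shiftFace_apply a _ _ _ (kappaGen_apply v), sum_kappaFactor]
  simp

/-- For the cyclic rack `X = ℤ/mℤ` with `i·j = i+1` and associated Yang-Baxter
solution `R(x,y) = (y+1, x−1)`, the maps `κ_n` form a chain map:
`∂_n^{YB} ∘ κ_n = κ_{n−1} ∘ ∂_n^{YB}` for all `n ≥ 2` (with the indexing here,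
`boundary R k : C_{k+1}^{YB} → C_k^{YB}` is the paper's `∂_{k+1}^{YB}`, so we
require `k ≥ 1`). -/
theorem stmt16 (m : ℕ) (hm : 0 < m) (k : ℕ) (hk : 1 ≤ k) :
    (boundary (fun p : ZMod m × ZMod m => (p.2 + 1, p.1 - 1)) k).comp
        (kappa (fun i _j : ZMod m => i + 1) (k + 1)) =
      (kappa (fun i _j : ZMod m => i + 1) k).comp
        (boundary (fun p : ZMod m × ZMod m => (p.2 + 1, p.1 - 1)) k) := by
  have : NeZero m := ⟨hm.ne'⟩
  refine Finsupp.addHom_ext' fun v => AddMonoidHom.ext_int ?_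
  have hκ : ∀ (n : ℕ) (u : Fin n → ZMod m),
      kappa (fun i _j : ZMod m => i + 1) n (Finsupp.single u 1) =
        kappaGen (fun i _j : ZMod m => i + 1) u := by
    intro n u
    simp [kappa]
  have hL := sum_mapDomain_shiftFace_kappaGen 0 v
  have hR := sum_mapDomain_shiftFace_kappaGen 1 v
  simp only [AddMonoidHom.comp_apply, Finsupp.singleAddHom_apply, hκ, boundary,
    Finset.sum_range, faceL_eq_shiftFace, faceR_eq_shiftFace, AddMonoidHom.finsetSum_apply,
    AddMonoidHom.smul_apply, AddMonoidHom.sub_apply, Finsupp.mapDomain.addMonoidHom_apply,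
    Finsupp.mapDomain_single, map_sum, map_zsmul, map_sub, smul_sub, Finset.sum_sub_distrib,
    hL, hR]
end

section
/- Let (X,·) be a Rump right quasigroup and let κ_n : C_n^{YB}(X) → C_n^{YB}(X) be the homomorphism determined on generators by κ_n(x₁,…,x_n) = (x₁ − x₂·x₂) ⊗ (x₂ − x₃·x₃) ⊗ ⋯ ⊗ (x_{n−1} − x_n·x_n) ⊗ x_n, expanded multilinearly. Then κ_n vanishes on the degenerate subgroup C_n^D(X); consequently Id − κ_n maps C_n^{YB}(X) into C_n^D(X) and restricts to the identity on C_n^D(X), so Id − κ_n is a section of the inclusion C_n^D(X) ↪ C_n^{YB}(X) and the short exact sequence 0 → C_n^D(X) → C_n^{YB}(X) → C_n^{YB}(X)/C_n^D(X) → 0 splits. -/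
/-- The tuple obtained from `v` by replacing its `i`-th entry by the square of the next one, for
every `i ∈ s` other than the last position. -/
def squareShift {X : Type*} (mul : X → X → X) {n : ℕ} (v : Fin n → X) (s : Finset (Fin n)) :
    Fin n → X :=
  fun i => if h : i ∈ s ∧ i.val + 1 < n then
    mul (v ⟨i.val + 1, h.2⟩) (v ⟨i.val + 1, h.2⟩) else v i

theorem kappaGen_eq_sum_squareShift {X : Type*} (mul : X → X → X) {n : ℕ} (v : Fin n → X) :
    kappaGen mul v = ∑ s ∈ (Finset.univ.filter fun i : Fin n => i.val + 1 < n).powerset,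
      ((-1 : ℤ) ^ s.card) • Finsupp.single (squareShift mul v s) 1 :=
  rfl

theorem squareShift_empty {X : Type*} (mul : X → X → X) {n : ℕ} (v : Fin n → X) :
    squareShift mul v ∅ = v := by
  ext i
  simp [squareShift]

theorem squareShift_insert {X : Type*} (mul : X → X → X) {n : ℕ} (v : Fin n → X) {j : ℕ}
    (hj : j + 1 < n)
    (hv : v ⟨j, Nat.lt_of_succ_lt hj⟩ = mul (v ⟨j + 1, hj⟩) (v ⟨j + 1, hj⟩))
    (s : Finset (Fin n)) :
    squareShift mul v (insert ⟨j, Nat.lt_of_succ_lt hj⟩ s) = squareShift mul v s := by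
  ext i
  by_cases hi : i = ⟨j, Nat.lt_of_succ_lt hj⟩
  · subst hi
    simp [squareShift, hj, hv]
  · simp [squareShift, hi]

theorem kappaGen_eq_zero {X : Type*} (mul : X → X → X) {n : ℕ} (v : Fin n → X) {j : ℕ}
    (hj : j + 1 < n)
    (hv : v ⟨j, Nat.lt_of_succ_lt hj⟩ = mul (v ⟨j + 1, hj⟩) (v ⟨j + 1, hj⟩)) :
    kappaGen mul v = 0 := by
  have hmem : (⟨j, Nat.lt_of_succ_lt hj⟩ : Fin n) ∈
      Finset.univ.filter fun i : Fin n => i.val + 1 < n := by simpa using hj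
  rw [kappaGen_eq_sum_squareShift, ← Finset.insert_erase hmem,
    Finset.sum_powerset_insert (Finset.notMem_erase _ _), ← Finset.sum_add_distrib]
  refine Finset.sum_eq_zero fun s hs => ?_
  have hjs : (⟨j, Nat.lt_of_succ_lt hj⟩ : Fin n) ∉ s := fun h =>
    Finset.notMem_erase _ _ (Finset.mem_powerset.mp hs h)
  rw [squareShift_insert mul v hj hv, Finset.card_insert_of_notMem hjs, pow_succ, mul_neg_one,
    neg_smul, add_neg_cancel]

theorem single_squareShift_mem_degen {X : Type*} (mul : X → X → X) {n : ℕ} (v : Fin n → X)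
    {s : Finset (Fin n)} (hs : s.Nonempty) (hlt : ∀ i ∈ s, i.val + 1 < n) :
    Finsupp.single (squareShift mul v s) 1 ∈ degen mul n := by
  have hmax := s.max'_mem hs
  have hj := hlt _ hmax
  have hnext : (⟨(s.max' hs).val + 1, hj⟩ : Fin n) ∉ s := fun h => by
    have := Fin.le_def.mp (s.le_max' _ h)
    simp at this
  refine AddSubgroup.subset_closure ⟨(s.max' hs).val, hj, _, ?_, rfl⟩
  simp [squareShift, hmax, hj, hnext]

theorem single_sub_kappaGen_mem_degen {X : Type*} (mul : X → X → X) {n : ℕ} (v : Fin n → X) :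
    Finsupp.single v 1 - kappaGen mul v ∈ degen mul n := by
  rw [kappaGen_eq_sum_squareShift, ← Finset.add_sum_erase _ _ (Finset.empty_mem_powerset _),
    squareShift_empty, Finset.card_empty, pow_zero, one_smul, sub_add_cancel_left]
  refine neg_mem (sum_mem fun s hs => zsmul_mem ?_ _)
  obtain ⟨hne, hsub⟩ := Finset.mem_erase.mp hs
  exact single_squareShift_mem_degen mul v (Finset.nonempty_iff_ne_empty.mpr hne) fun i hi => by
    simpa using Finset.mem_powerset.mp hsub hi

theorem kappa_single {X : Type*} (mul : X → X → X) {n : ℕ} (v : Fin n → X) (a : ℤ) :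
    kappa mul n (Finsupp.single v a) = a • kappaGen mul v := by
  simp [kappa]

theorem kappa_eq_zero_of_mem_degen {X : Type*} (mul : X → X → X) {n : ℕ} {c : CYB X n}
    (hc : c ∈ degen mul n) : kappa mul n c = 0 := by
  suffices degen mul n ≤ (kappa mul n).ker from this hc
  refine (AddSubgroup.closure_le _).mpr ?_
  rintro _ ⟨j, hj, v, hv, rfl⟩
  simp [AddMonoidHom.mem_ker, kappa_single, kappaGen_eq_zero mul v hj hv]

theorem sub_kappa_mem_degen {X : Type*} (mul : X → X → X) {n : ℕ} (c : CYB X n) :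
    c - kappa mul n c ∈ degen mul n := by
  induction c using Finsupp.induction_linear with
  | zero => simp
  | add f g hf hg =>
    rw [map_add, add_sub_add_comm]
    exact add_mem hf hg
  | single v a =>
    have h := zsmul_mem (single_sub_kappaGen_mem_degen mul v) a
    rwa [smul_sub, Finsupp.smul_single, smul_eq_mul, mul_one, ← kappa_single] at h

/-- For a Rump right quasigroup `(X, mul)`, the map `κ_n` vanishes on the
degenerate subgroup `C_n^D(X)`; consequently `Id − κ_n` maps `C_n^{YB}(X)` into
`C_n^D(X)` and restricts to the identity on `C_n^D(X)`, i.e. `Id − κ_n` is a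
section of the inclusion `C_n^D(X) ↪ C_n^{YB}(X)`, so the short exact sequence
`0 → C_n^D(X) → C_n^{YB}(X) → C_n^{YB}(X)/C_n^D(X) → 0` splits. -/
theorem stmt17 {X : Type*} (mul div : X → X → X)
    (hdm : ∀ x y, mul (div x y) y = x) (hmd : ∀ x y, div (mul x y) y = x)
    (rump : ∀ x y z, mul (mul z x) (mul y x) = mul (mul z y) (mul x y))
    (n : ℕ) :
    (∀ c ∈ degen mul n, kappa mul n c = 0) ∧
    (∀ c : CYB X n, c - kappa mul n c ∈ degen mul n) ∧
    (∀ c ∈ degen mul n, c - kappa mul n c = c) := by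
  refine ⟨fun c hc => kappa_eq_zero_of_mem_degen mul hc, sub_kappa_mem_degen mul, fun c hc => ?_⟩
  rw [kappa_eq_zero_of_mem_degen mul hc, sub_zero]
end
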